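/- Suppose the Bayesian mechanism satisfies Assumptions 1 and 2, the utilities are quasilinear and nonnegative, and the mechanism is (λ,μ)-conditionally smooth with λ ≥ 0 and μ ≥ 0. Then for every type-wise distribution π that is a communication equilibrium with strategy representability: E_{θ∼ρ} E_{a∼π(θ)}[v_SW(θ; a)] ≥ (λ/max{1,μ}) · E_{θ∼ρ}[ max_{a∈A} v_SW(θ; a) ]. In particular, the price of anarchy over communication equilibria with strategy representability is at least λ/max{1,μ}. -/

import Mathlib

open Finset
open scoped Classical

noncomputable section

/-- `f` is a probability distribution on the finite set `X`. -/
def IsDist {X : Type*} [Fintype X] (f : X → ℝ) : Prop :=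
  (∀ x, f x ∈ Set.Icc (0 : ℝ) 1) ∧ ∑ x, f x = 1

variable {ι : Type*} [Fintype ι] [Nonempty ι]
  {Θ A X : ι → Type*}
  [∀ i, Fintype (Θ i)] [∀ i, Nonempty (Θ i)]
  [∀ i, Fintype (A i)] [∀ i, Nonempty (A i)]
  [∀ i, Fintype (X i)] [∀ i, Nonempty (X i)]

/-- The map `η : Δ(S) → Δ(A)^Θ` : `η(σ)(θ;a) = ∑_{s : s(θ) = a} σ(s)`. -/
def eta (σ : ((i : ι) → Θ i → A i) → ℝ) :
    ((i : ι) → Θ i) → ((i : ι) → A i) → ℝ :=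
  fun θ a => ∑ s : (i : ι) → Θ i → A i, if (fun i => s i (θ i)) = a then σ s else 0

/-- `π` is strategy-representable if it is realized by a distribution over strategy profiles. -/
def StrategyRepresentable (π : ((i : ι) → Θ i) → ((i : ι) → A i) → ℝ) : Prop :=
  ∃ σ : ((i : ι) → Θ i → A i) → ℝ, IsDist σ ∧ eta σ = π

/-- Communication equilibrium (exact incentive constraints). -/
def IsCommEq (ρ : ((i : ι) → Θ i) → ℝ)
    (v : (i : ι) → ((j : ι) → Θ j) → ((j : ι) → A j) → ℝ)
    (π : ((i : ι) → Θ i) → ((i : ι) → A i) → ℝ) : Prop :=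
  ∀ (i : ι) (ψ : Θ i → Θ i) (φ : Θ i → A i → A i),
    ∑ θ, ρ θ * ∑ a : (j : ι) → A j, π θ a * v i θ a ≥
      ∑ θ, ρ θ * ∑ a : (j : ι) → A j,
        π (Function.update θ i (ψ (θ i))) a *
          v i θ (Function.update a i (φ (θ i) (a i)))

theorem prod_update_mul_prod_update {κ : Type*} [Fintype κ] {T : κ → Type*}
    (r : (k : κ) → T k → ℝ) (i : κ) (x y : (k : κ) → T k) :
    (∏ k, r k (Function.update x i (y i) k)) * (∏ k, r k (Function.update y i (x i) k)) =
      (∏ k, r k (x k)) * ∏ k, r k (y k) := by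
  rw [← Finset.prod_mul_distrib, ← Finset.prod_mul_distrib]
  refine Finset.prod_congr rfl fun k _ => ?_
  by_cases hk : k = i
  · subst hk
    simp [mul_comm]
  · simp [hk]

/-- Exchanging the `i`-th coordinates of two independent samples from a product distribution
does not change expectations. -/
theorem sum_sum_update_swap {κ : Type*} [Fintype κ] {T : κ → Type*} [∀ k, Fintype (T k)]
    (r : (k : κ) → T k → ℝ) (i : κ) (G : ((k : κ) → T k) → ((k : κ) → T k) → ℝ) :
    ∑ x : (k : κ) → T k, ∑ y : (k : κ) → T k, (∏ k, r k (x k)) * (∏ k, r k (y k)) *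
        G (Function.update x i (y i)) (Function.update y i (x i)) =
      ∑ x : (k : κ) → T k, ∑ y : (k : κ) → T k,
        (∏ k, r k (x k)) * (∏ k, r k (y k)) * G x y := by
  have hinv : Function.Involutive fun p : ((k : κ) → T k) × ((k : κ) → T k) =>
      (Function.update p.1 i (p.2 i), Function.update p.2 i (p.1 i)) := by
    rintro ⟨x, y⟩
    simp
  rw [← Fintype.sum_prod_type', ← Fintype.sum_prod_type']
  refine Fintype.sum_equiv hinv.toPerm _ _ fun p => ?_
  simp only [Function.Involutive.coe_toPerm]
  rw [prod_update_mul_prod_update]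

theorem sum_pi_prod_eq_one {κ : Type*} [Fintype κ] {T : κ → Type*} [∀ k, Fintype (T k)]
    (r : (k : κ) → T k → ℝ) (hr : ∀ k, IsDist (r k)) :
    ∑ x : (k : κ) → T k, ∏ k, r k (x k) = 1 := by
  rw [← Fintype.prod_sum]
  exact Finset.prod_eq_one fun k _ => (hr k).2

/-- Under a product prior, no player of a communication equilibrium gains by independently
sampling a type profile `y`, reporting `y i`, and reacting to the recommendation as if the other
types were those in `y`. -/
theorem IsCommEq.resampling_deviation_le {κ : Type*} [Fintype κ] {T B : κ → Type*}
    [∀ k, Fintype (T k)] [∀ k, Fintype (B k)]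
    {r : (k : κ) → T k → ℝ} (hr : ∀ k, IsDist (r k))
    {u : (k : κ) → T k → ((k : κ) → B k) → ℝ}
    {π : ((k : κ) → T k) → ((k : κ) → B k) → ℝ}
    (h : IsCommEq (fun x => ∏ k, r k (x k)) (fun k x a => u k (x k) a) π)
    (i : κ) (d : ((k : κ) → T k) → B i → B i) :
    ∑ x : (k : κ) → T k, ∑ y : (k : κ) → T k, (∏ k, r k (x k)) * (∏ k, r k (y k)) *
        ∑ a : (k : κ) → B k, π x a * u i (y i) (Function.update a i (d y (a i))) ≤
      ∑ x : (k : κ) → T k, (∏ k, r k (x k)) * ∑ a : (k : κ) → B k, π x a * u i (x i) a := by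
  rw [← sum_sum_update_swap r i fun x y =>
    ∑ a : (k : κ) → B k, π x a * u i (y i) (Function.update a i (d y (a i))), Finset.sum_comm]
  calc _ ≤ ∑ y : (k : κ) → T k, (∏ k, r k (y k)) *
          ∑ x : (k : κ) → T k, (∏ k, r k (x k)) *
            ∑ a : (k : κ) → B k, π x a * u i (x i) a := by
        refine Finset.sum_le_sum fun y _ => ?_
        have hy := h i (fun _ => y i) fun t => d (Function.update y i t)
        refine le_trans (le_of_eq ?_) (mul_le_mul_of_nonneg_left hy.le
          (Finset.prod_nonneg fun k _ => ((hr k).1 (y k)).1))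
        rw [Finset.mul_sum]
        refine Finset.sum_congr rfl fun x _ => ?_
        simp only [Function.update_self]
        ring
    _ = _ := by rw [← Finset.sum_mul, sum_pi_prod_eq_one r hr, one_mul]

/-- Price-of-anarchy bound for (λ,μ)-conditionally smooth quasilinear Bayesian mechanisms
over communication equilibria with strategy representability. -/
theorem poa_smooth_mechanism
    (ρi : (i : ι) → Θ i → ℝ) (hρi : ∀ i, IsDist (ρi i))
    (f : (i : ι) → ((j : ι) → A j) → X i)
    (vplus : (i : ι) → Θ i → X i → ℝ)
    (hvplus : ∀ i θi xi, vplus i θi xi ∈ Set.Icc (0 : ℝ) 1)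
    (vminus : (i : ι) → ((j : ι) → A j) → ℝ)
    (hvminus : ∀ i a, vminus i a ∈ Set.Icc (0 : ℝ) 1)
    (hnonneg : ∀ (i : ι) (θi : Θ i) (a : (j : ι) → A j),
      0 ≤ vplus i θi (f i a) - vminus i a)
    (lam mu : ℝ) (hlam : 0 ≤ lam) (hmu : 0 ≤ mu)
    (hsmooth : ∃ astar : (i : ι) → ((j : ι) → Θ j) → A i → A i,
      ∀ (θ : (j : ι) → Θ j) (a : (j : ι) → A j),
        ∑ i, (vplus i (θ i) (f i (Function.update a i (astar i θ (a i)))) -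
            vminus i (Function.update a i (astar i θ (a i)))) ≥
          lam * (⨆ a' : (j : ι) → A j, ∑ i, vplus i (θ i) (f i a')) -
            mu * ∑ i, vminus i a)
    (π : ((i : ι) → Θ i) → ((i : ι) → A i) → ℝ)
    (hπ : ∀ θ, IsDist (π θ))
    (hSR : StrategyRepresentable π)
    (hComm : IsCommEq (fun θ => ∏ j, ρi j (θ j))
      (fun i θ a => vplus i (θ i) (f i a) - vminus i a) π) :
    ∑ θ : (j : ι) → Θ j, (∏ j, ρi j (θ j)) *
        ∑ a : (j : ι) → A j, π θ a * (∑ i, vplus i (θ i) (f i a)) ≥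
      (lam / max 1 mu) *
        ∑ θ : (j : ι) → Θ j, (∏ j, ρi j (θ j)) *
          (⨆ a : (j : ι) → A j, ∑ i, vplus i (θ i) (f i a)) := by
  obtain ⟨astar, hs⟩ := hsmooth
  set R : ((j : ι) → Θ j) → ℝ := fun θ => ∏ j, ρi j (θ j)
  have hR0 : ∀ θ, 0 ≤ R θ := fun θ => Finset.prod_nonneg fun j _ => ((hρi j).1 (θ j)).1
  have hR1 : ∑ θ, R θ = 1 := sum_pi_prod_eq_one ρi hρi
  have hπ0 : ∀ θ a, 0 ≤ π θ a := fun θ a => ((hπ θ).1 a).1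
  set opt : ((j : ι) → Θ j) → ℝ :=
    fun θ => ⨆ a : (j : ι) → A j, ∑ i, vplus i (θ i) (f i a)
  change ∑ θ, R θ * ∑ a : (j : ι) → A j, π θ a * (∑ i, vplus i (θ i) (f i a)) ≥
    (lam / max 1 mu) * ∑ θ, R θ * opt θ
  set SW := ∑ θ, R θ * ∑ a : (j : ι) → A j, π θ a * (∑ i, vplus i (θ i) (f i a)) with hSW
  set OPT := ∑ θ, R θ * opt θ with hOPT
  set P := ∑ θ, R θ * ∑ a : (j : ι) → A j, π θ a * (∑ i, vminus i a) with hP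
  have hP0 : 0 ≤ P := Finset.sum_nonneg fun θ _ => mul_nonneg (hR0 θ) <|
    Finset.sum_nonneg fun a _ => mul_nonneg (hπ0 θ a) <|
      Finset.sum_nonneg fun i _ => (hvminus i a).1
  have hPSW : P ≤ SW := Finset.sum_le_sum fun θ _ => mul_le_mul_of_nonneg_left
    (Finset.sum_le_sum fun a _ => mul_le_mul_of_nonneg_left
      (Finset.sum_le_sum fun i _ => sub_nonneg.1 (hnonneg i (θ i) a)) (hπ0 θ a)) (hR0 θ)
  have hutil : ∑ i, ∑ θ, R θ * ∑ a : (j : ι) → A j,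
      π θ a * (vplus i (θ i) (f i a) - vminus i a) = SW - P := by
    rw [Finset.sum_comm, hSW, hP, ← Finset.sum_sub_distrib]
    refine Finset.sum_congr rfl fun θ _ => ?_
    rw [← Finset.mul_sum, ← mul_sub, Finset.sum_comm, ← Finset.sum_sub_distrib]
    simp only [← Finset.mul_sum, Finset.sum_sub_distrib, mul_sub]
  have hdev : ∑ i, ∑ x, ∑ y, R x * R y * ∑ a : (j : ι) → A j, π x a *
      (vplus i (y i) (f i (Function.update a i (astar i y (a i)))) -
        vminus i (Function.update a i (astar i y (a i)))) ≤ SW - P := by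
    rw [← hutil]
    exact Finset.sum_le_sum fun i _ => IsCommEq.resampling_deviation_le hρi
      (u := fun i t a => vplus i t (f i a) - vminus i a) hComm i (astar i)
  have hlower : lam * OPT - mu * P ≤ ∑ i, ∑ x, ∑ y, R x * R y * ∑ a : (j : ι) → A j, π x a *
      (vplus i (y i) (f i (Function.update a i (astar i y (a i)))) -
        vminus i (Function.update a i (astar i y (a i)))) := by
    calc lam * OPT - mu * P
        = ∑ x, ∑ y, R x * R y * (lam * opt y -
            mu * ∑ a : (j : ι) → A j, π x a * ∑ i, vminus i a) := by
          simp only [mul_sub, Finset.sum_sub_distrib]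
          congr 1
          · rw [← one_mul (lam * OPT), ← hR1, hOPT, Finset.mul_sum, Finset.sum_mul_sum]
            exact Finset.sum_congr rfl fun x _ => Finset.sum_congr rfl fun y _ => by ring
          · rw [← mul_one (mu * P), ← hR1, hP, Finset.mul_sum _ _ mu, Finset.sum_mul_sum]
            exact Finset.sum_congr rfl fun x _ => Finset.sum_congr rfl fun y _ => by ring
      _ = ∑ x, ∑ y, R x * R y * ∑ a : (j : ι) → A j, π x a *
            (lam * opt y - mu * ∑ i, vminus i a) := by
          refine Finset.sum_congr rfl fun x _ => Finset.sum_congr rfl fun y _ => ?_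
          simp only [mul_sub, Finset.sum_sub_distrib]
          rw [← Finset.sum_mul, (hπ x).2, one_mul, Finset.mul_sum univ _ mu]
          simp only [mul_left_comm mu]
      _ ≤ ∑ x, ∑ y, R x * R y * ∑ a : (j : ι) → A j, π x a *
            ∑ i, (vplus i (y i) (f i (Function.update a i (astar i y (a i)))) -
              vminus i (Function.update a i (astar i y (a i)))) :=
          Finset.sum_le_sum fun x _ => Finset.sum_le_sum fun y _ =>
            mul_le_mul_of_nonneg_left (Finset.sum_le_sum fun a _ =>
              mul_le_mul_of_nonneg_left (hs y a) (hπ0 x a)) (mul_nonneg (hR0 x) (hR0 y))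
      _ = _ := by
          rw [Finset.sum_comm (s := (univ : Finset ι))]
          refine Finset.sum_congr rfl fun x _ => ?_
          rw [Finset.sum_comm (s := (univ : Finset ι))]
          refine Finset.sum_congr rfl fun y _ => ?_
          rw [← Finset.mul_sum, Finset.sum_comm (s := (univ : Finset ι))]
          simp only [Finset.mul_sum]
  have key : lam * OPT - mu * P ≤ SW - P := hlower.trans hdev
  rw [ge_iff_le, div_mul_eq_mul_div, div_le_iff₀ (lt_max_of_lt_left one_pos)]
  rcases le_total mu 1 with h | h
  · rw [max_eq_left h]
    nlinarith
  · rw [max_eq_right h]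
    nlinarith
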